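/- Let n ≥ 2 and let 𝒜 be of nonstandard p(·)-growth with constants a₋, b⁺, where the bounded exponent p satisfies p⁻ < n. Let α ∈ ℝ with α > n/p⁻ − 1, and suppose there exist c > 0 and an increasing sequence of radii R_k → ∞ such that sup_{x ∈ B_{2R_k}∖B_{R_k}} |u(x)| ≤ c · R_k^{−α} for every k. If u is a bounded 𝒜-harmonic function in ℝⁿ, then u is constant. -/

import Mathlib

open MeasureTheory Metric Real
open scoped ContDiff

noncomputable section

abbrev Euc (n : ℕ) := EuclideanSpace ℝ (Fin n)

/-- Measure of the unit ball in `ℝⁿ`. -/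
def omegaEuc (n : ℕ) : ℝ := (volume (Metric.ball (0 : Euc n) 1)).toReal

/-- A measurable variable exponent `p` with `p⁻ = pm` and `p⁺ = pP`,
`1 < p⁻` and `p⁺ < ∞` (encoded by the a.e. bounds). -/
structure IsVarExp {n : ℕ} (p : Euc n → ℝ) (pm pP : ℝ) : Prop where
  meas : Measurable p
  one_lt : 1 < pm
  inf_eq : essInf p (volume : Measure (Euc n)) = pm
  sup_eq : essSup p (volume : Measure (Euc n)) = pP
  ae_lb : ∀ᵐ x ∂(volume : Measure (Euc n)), pm ≤ p x
  ae_ub : ∀ᵐ x ∂(volume : Measure (Euc n)), p x ≤ pP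

/-- `𝒜` is of nonstandard `p(·)`-growth with constants `am = a₋`, `bP = b⁺`. -/
structure IsNSGrowth {n : ℕ} (p : Euc n → ℝ) (𝒜 : Euc n → ℝ → Euc n → Euc n)
    (am bP : ℝ) : Prop where
  am_pos : 0 < am
  meas : ∀ (t : ℝ) (ξ : Euc n), Measurable (fun x => 𝒜 x t ξ)
  cont : ∀ x : Euc n, Continuous (fun tξ : ℝ × Euc n => 𝒜 x tξ.1 tξ.2)
  growth : ∃ a b : Euc n → ℝ, Measurable a ∧ Measurable b ∧
      (∀ x, am ≤ a x ∧ a x ≤ b x ∧ b x ≤ bP) ∧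
      (∀ x t ξ, a x * ‖ξ‖ ^ p x ≤ (inner ℝ (𝒜 x t ξ) ξ : ℝ)) ∧
      (∀ x t ξ, ‖𝒜 x t ξ‖ ≤ b x * ‖ξ‖ ^ (p x - 1))

/-- `u` is `𝒜`-harmonic in `ℝⁿ` (C¹ functions replace `W^{1,p(·)}_loc`). -/
def IsAHarmonic {n : ℕ} (p : Euc n → ℝ) (𝒜 : Euc n → ℝ → Euc n → Euc n)
    (u : Euc n → ℝ) : Prop :=
  ContDiff ℝ 1 u ∧
  LocallyIntegrable (fun x => ‖gradient u x‖ ^ p x) (volume : Measure (Euc n)) ∧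
  ∀ φ : Euc n → ℝ, ContDiff ℝ ∞ φ → HasCompactSupport φ →
    ∫ x, (inner ℝ (𝒜 x (u x) (gradient u x)) (gradient φ x) : ℝ) = 0

/-- `u` is an `𝒜`-subsolution in `ℝⁿ`. -/
def IsASubsolution {n : ℕ} (p : Euc n → ℝ) (𝒜 : Euc n → ℝ → Euc n → Euc n)
    (u : Euc n → ℝ) : Prop :=
  ContDiff ℝ 1 u ∧
  LocallyIntegrable (fun x => ‖gradient u x‖ ^ p x) (volume : Measure (Euc n)) ∧
  ∀ φ : Euc n → ℝ, ContDiff ℝ ∞ φ → HasCompactSupport φ → (∀ x, 0 ≤ φ x) →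
    ∫ x, (inner ℝ (𝒜 x (u x) (gradient u x)) (gradient φ x) : ℝ) ≤ 0

/-- `ℬ` is an admissible right-hand side. -/
structure IsAdmissibleRHS {n : ℕ} (p : Euc n → ℝ) (ℬ : Euc n → ℝ → Euc n → ℝ) : Prop where
  meas : ∀ (t : ℝ) (ξ : Euc n), Measurable (fun x => ℬ x t ξ)
  cont : ∀ x : Euc n, Continuous (fun tξ : ℝ × Euc n => ℬ x tξ.1 tξ.2)
  bound : ∃ c : Euc n → ℝ, Measurable c ∧ (∃ cP : ℝ, ∀ x, c x ≤ cP) ∧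
      ∀ x t ξ, |ℬ x t ξ| ≤ c x * (1 + ‖ξ‖ ^ (p x - 1))

/-- `u` is `(𝒜,ℬ)`-harmonic in `ℝⁿ`. -/
def IsABHarmonic {n : ℕ} (p : Euc n → ℝ) (𝒜 : Euc n → ℝ → Euc n → Euc n)
    (ℬ : Euc n → ℝ → Euc n → ℝ) (u : Euc n → ℝ) : Prop :=
  ContDiff ℝ 1 u ∧
  LocallyIntegrable (fun x => ‖gradient u x‖ ^ p x) (volume : Measure (Euc n)) ∧
  ∀ φ : Euc n → ℝ, ContDiff ℝ ∞ φ → HasCompactSupport φ →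
    ∫ x, (inner ℝ (𝒜 x (u x) (gradient u x)) (gradient φ x) : ℝ)
      = ∫ x, ℬ x (u x) (gradient u x) * φ x

/-- `u` is a supersolution of `div 𝒜(x,u,∇u) = f(u)` in `ℝⁿ`. -/
def IsFSupersolution {n : ℕ} (p : Euc n → ℝ) (𝒜 : Euc n → ℝ → Euc n → Euc n)
    (f : ℝ → ℝ) (u : Euc n → ℝ) : Prop :=
  ContDiff ℝ 1 u ∧
  LocallyIntegrable (fun x => ‖gradient u x‖ ^ p x) (volume : Measure (Euc n)) ∧
  ∀ φ : Euc n → ℝ, ContDiff ℝ ∞ φ → HasCompactSupport φ → (∀ x, 0 ≤ φ x) →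
    ∫ x, f (u x) * φ x ≤ - ∫ x, (inner ℝ (𝒜 x (u x) (gradient u x)) (gradient φ x) : ℝ)

/-- Mollification: a compactly supported `C¹` function is approximated in `C¹` by smooth functions
supported in a fixed neighbourhood of its support. -/
lemma exists_contDiff_fderiv_sub_le {n : ℕ} {g : Euc n → ℝ} (hg : ContDiff ℝ 1 g)
    (hgc : HasCompactSupport g) {ε : ℝ} (hε : 0 < ε) :
    ∃ φ : Euc n → ℝ, ContDiff ℝ ∞ φ ∧ HasCompactSupport φ ∧
      tsupport φ ⊆ Metric.cthickening 1 (tsupport g) ∧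
      ∀ x, ‖fderiv ℝ φ x - fderiv ℝ g x‖ ≤ ε := by
  have hcont : Continuous (fderiv ℝ g) := hg.continuous_fderiv one_ne_zero
  have huc : UniformContinuous (fderiv ℝ g) :=
    (hgc.fderiv (𝕜 := ℝ)).uniformContinuous_of_continuous hcont
  obtain ⟨δ, hδ, hδε⟩ := Metric.uniformContinuous_iff.1 huc ε hε
  let ρ : ContDiffBump (0 : Euc n) := ⟨min δ 1 / 2, min δ 1, by positivity,
    half_lt_self (by positivity)⟩
  let φ : Euc n → ℝ :=
    MeasureTheory.convolution (ρ.normed volume) g (ContinuousLinearMap.lsmul ℝ ℝ) volume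
  have hρi : LocallyIntegrable (ρ.normed (volume : Measure (Euc n))) :=
    ρ.continuous_normed.locallyIntegrable
  have hsupp : Function.support φ ⊆ Metric.cthickening 1 (tsupport g) := by
    intro x hx
    obtain ⟨a, ha, b, hb, rfl⟩ :=
      support_convolution_subset (ContinuousLinearMap.lsmul ℝ ℝ) hx
    rw [ρ.support_normed_eq, mem_ball_zero_iff] at ha
    refine Metric.mem_cthickening_of_dist_le _ b _ _ (subset_closure hb) ?_
    rw [dist_eq_norm, add_sub_cancel_right]
    exact ha.le.trans (min_le_right _ _)
  refine ⟨φ, ?_, ?_, closure_minimal hsupp Metric.isClosed_cthickening, fun x ↦ ?_⟩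
  · exact ρ.hasCompactSupport_normed.contDiff_convolution_left _ ρ.contDiff_normed
      hg.continuous.locallyIntegrable
  · exact ρ.hasCompactSupport_normed.convolution _ hgc
  · have hd := hgc.hasFDerivAt_convolution_right (ContinuousLinearMap.lsmul ℝ ℝ) hρi hg x
    have heq : ((ContinuousLinearMap.lsmul ℝ ℝ : ℝ →L[ℝ] ℝ →L[ℝ] ℝ).precompR (Euc n)) =
        (ContinuousLinearMap.lsmul ℝ ℝ : ℝ →L[ℝ] (Euc n →L[ℝ] ℝ) →L[ℝ] (Euc n →L[ℝ] ℝ)) := by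
      ext; rfl
    rw [heq] at hd
    rw [hd.fderiv, ← dist_eq_norm]
    refine ρ.dist_normed_convolution_le hcont.aestronglyMeasurable fun y hy ↦ (hδε ?_).le
    exact lt_of_lt_of_le hy (min_le_left _ _)

/-- The pairing of a locally integrable field with the gradient of a compactly supported `C¹`
function is integrable. -/
lemma integrable_inner_gradient {n : ℕ} {F : Euc n → Euc n} (hF : LocallyIntegrable F)
    {g : Euc n → ℝ} (hg : ContDiff ℝ 1 g) (hgc : HasCompactSupport g) :
    Integrable (fun x ↦ inner ℝ (F x) (gradient g x)) := by
  have hcont : Continuous (gradient g) :=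
    (InnerProductSpace.toDual ℝ (Euc n)).symm.continuous.comp (hg.continuous_fderiv one_ne_zero)
  obtain ⟨L, hL⟩ := (hg.continuous_fderiv one_ne_zero).bounded_above_of_compact_support
    (hgc.fderiv (𝕜 := ℝ))
  have hK : IntegrableOn F (tsupport g) := hF.integrableOn_isCompact hgc
  have hind : Integrable ((tsupport g).indicator F) :=
    (integrable_indicator_iff (isClosed_tsupport g).measurableSet).2 hK
  refine (hind.norm.mul_const L).mono'
    (hF.aestronglyMeasurable.inner hcont.aestronglyMeasurable) (.of_forall fun x ↦ ?_)
  have h1 : inner ℝ (F x) (gradient g x) = fderiv ℝ g x (F x) := by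
    rw [inner_gradient_right]; rfl
  rw [h1]
  by_cases hx : x ∈ tsupport g
  · rw [Set.indicator_of_mem hx, mul_comm]
    exact (ContinuousLinearMap.le_opNorm _ _).trans
      (mul_le_mul_of_nonneg_right (hL x) (norm_nonneg _))
  · have : fderiv ℝ g x = 0 := by
      by_contra h
      exact hx (support_fderiv_subset ℝ h)
    simp [this, hx]

/-- A locally integrable field that is weakly divergence free against smooth test functions is so
against compactly supported `C¹` test functions. -/
lemma integral_inner_gradient_eq_zero {n : ℕ} {F : Euc n → Euc n} (hF : LocallyIntegrable F)
    (h : ∀ φ : Euc n → ℝ, ContDiff ℝ ∞ φ → HasCompactSupport φ →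
      ∫ x, inner ℝ (F x) (gradient φ x) = 0)
    {g : Euc n → ℝ} (hg : ContDiff ℝ 1 g) (hgc : HasCompactSupport g) :
    ∫ x, inner ℝ (F x) (gradient g x) = 0 := by
  set K := Metric.cthickening 1 (tsupport g)
  have hKc : IsCompact K := IsCompact.cthickening hgc
  have hFK : IntegrableOn F K := hF.integrableOn_isCompact hKc
  have hKm : MeasurableSet K := Metric.isClosed_cthickening.measurableSet
  have hind : Integrable (K.indicator F) := (integrable_indicator_iff hKm).2 hFK
  set I := ∫ x, ‖K.indicator F x‖ with hI
  have hI0 : 0 ≤ I := integral_nonneg fun x ↦ norm_nonneg _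
  have key : ∀ ε > 0, |∫ x, inner ℝ (F x) (gradient g x)| ≤ ε * I := by
    intro ε hε
    obtain ⟨φ, hφ, hφc, hφs, hφd⟩ := exists_contDiff_fderiv_sub_le hg hgc hε
    have hφ1 : ContDiff ℝ 1 φ := hφ.of_le (by exact_mod_cast le_top)
    have h0 : ∫ x, inner ℝ (F x) (gradient g x) =
        ∫ x, (inner ℝ (F x) (gradient g x) - inner ℝ (F x) (gradient φ x)) := by
      rw [integral_sub (integrable_inner_gradient hF hg hgc)
        (integrable_inner_gradient hF hφ1 hφc), h φ hφ hφc, sub_zero]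
    rw [h0, hI, ← integral_const_mul, ← Real.norm_eq_abs]
    refine norm_integral_le_of_norm_le (hind.norm.const_mul ε) (.of_forall fun x ↦ ?_)
    have h1 : inner ℝ (F x) (gradient g x) - inner ℝ (F x) (gradient φ x) =
        (fderiv ℝ g x - fderiv ℝ φ x) (F x) := by
      rw [inner_gradient_right, inner_gradient_right]; rfl
    rw [h1]
    by_cases hx : x ∈ K
    · rw [Set.indicator_of_mem hx]
      refine (ContinuousLinearMap.le_opNorm _ _).trans
        (mul_le_mul_of_nonneg_right ?_ (norm_nonneg _))
      rw [norm_sub_rev]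
      exact hφd x
    · have e1 : fderiv ℝ g x = 0 := by
        by_contra h'
        exact hx (Metric.self_subset_cthickening _ (support_fderiv_subset ℝ h'))
      have e2 : fderiv ℝ φ x = 0 := by
        by_contra h'
        exact hx (hφs (support_fderiv_subset ℝ h'))
      simp [e1, e2, hx]
  by_contra hne
  have hpos : 0 < |∫ x, inner ℝ (F x) (gradient g x)| := abs_pos.2 hne
  have := key (|∫ x, inner ℝ (F x) (gradient g x)| / (2 * (I + 1))) (by positivity)
  rw [div_mul_eq_mul_div, le_div_iff₀ (by positivity)] at this
  nlinarith

/-- A Young-type inequality with a cutoff value `η`. -/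
lemma mul_rpow_sub_one_mul_pow_le {s η Y q : ℝ} {m : ℕ} (hs : 0 ≤ s) (hη : 0 ≤ η) (hη1 : η ≤ 1)
    (hY : 0 ≤ Y) (hq : 1 < q) (hqm : q ≤ m + 1) :
    Y * s ^ (q - 1) * η ^ m ≤ s ^ q * η ^ (m + 1) + Y ^ q := by
  have hsplit : ∀ t : ℝ, 0 ≤ t → t ^ q = t * t ^ (q - 1) := by
    intro t ht
    rcases ht.eq_or_lt with rfl | ht
    · rw [Real.zero_rpow (by linarith), zero_mul]
    · rw [Real.rpow_sub_one ht.ne']; field_simp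
  have hs1 : 0 ≤ s ^ (q - 1) := Real.rpow_nonneg hs _
  have hm : 0 ≤ η ^ m := pow_nonneg hη m
  rcases le_total Y (s * η) with h | h
  · have h1 : Y * s ^ (q - 1) * η ^ m ≤ s ^ q * η ^ (m + 1) := by
      calc Y * s ^ (q - 1) * η ^ m ≤ (s * η) * s ^ (q - 1) * η ^ m := by gcongr
        _ = s ^ q * η ^ (m + 1) := by rw [hsplit s hs]; ring
    linarith [Real.rpow_nonneg hY q]
  · have h0 : η ^ m ≤ η ^ (q - 1) := by
      rcases hη.eq_or_lt with rfl | hpos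
      · have : m ≠ 0 := by
          rintro rfl
          norm_num at hqm
          linarith
        rw [zero_pow this]
        exact Real.rpow_nonneg le_rfl _
      · rw [← Real.rpow_natCast]
        exact Real.rpow_le_rpow_of_exponent_ge hpos hη1 (by linarith)
    have h1 : Y * s ^ (q - 1) * η ^ m ≤ Y ^ q := by
      calc Y * s ^ (q - 1) * η ^ m ≤ Y * s ^ (q - 1) * η ^ (q - 1) := by gcongr
        _ = Y * (s * η) ^ (q - 1) := by rw [Real.mul_rpow hs hη]; ring
        _ ≤ Y * Y ^ (q - 1) := by gcongr
        _ = Y ^ q := (hsplit Y hY).symm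
    have : 0 ≤ s ^ q * η ^ (m + 1) := mul_nonneg (Real.rpow_nonneg hs _) (pow_nonneg hη _)
    linarith

/-- The flux `𝒜(x, u, ∇u)` of an `𝒜`-harmonic function is locally integrable. -/
lemma IsAHarmonic.locallyIntegrable_flux {n : ℕ} {p : Euc n → ℝ} {pm pP : ℝ}
    (hp : IsVarExp p pm pP) {𝒜 : Euc n → ℝ → Euc n → Euc n} {am bP : ℝ}
    (h𝒜 : IsNSGrowth p 𝒜 am bP) {u : Euc n → ℝ} (hu : IsAHarmonic p 𝒜 u) :
    LocallyIntegrable (fun x ↦ 𝒜 x (u x) (gradient u x)) := by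
  obtain ⟨a, b, -, -, hab, -, hbd⟩ := h𝒜.growth
  have hgrad : Continuous (gradient u) :=
    (InnerProductSpace.toDual ℝ (Euc n)).symm.continuous.comp
      (hu.1.continuous_fderiv one_ne_zero)
  have hmeas : Measurable (fun x ↦ 𝒜 x (u x) (gradient u x)) := by
    have h := measurable_uncurry_of_continuous_of_measurable
      (u := fun (tξ : ℝ × Euc n) x ↦ 𝒜 x tξ.1 tξ.2) h𝒜.cont (fun i ↦ h𝒜.meas i.1 i.2)
    exact h.comp ((hu.1.continuous.measurable.prodMk hgrad.measurable).prodMk measurable_id)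
  have hb0 : 0 ≤ bP := by
    have := hab 0
    linarith [h𝒜.am_pos]
  have hdom : LocallyIntegrable (fun x ↦ bP * (1 + ‖gradient u x‖ ^ p x)) :=
    ((locallyIntegrable_const (1 : ℝ)).add hu.2.1).smul bP
  refine hdom.mono hmeas.aestronglyMeasurable ?_
  filter_upwards [hp.ae_lb] with x hx
  have hs := norm_nonneg (gradient u x)
  have hpx : 1 < p x := hp.one_lt.trans_le hx
  have h1 : ‖gradient u x‖ ^ (p x - 1) ≤ 1 + ‖gradient u x‖ ^ p x := by
    rcases le_total ‖gradient u x‖ 1 with h | h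
    · linarith [Real.rpow_le_one hs h (by linarith : 0 ≤ p x - 1), Real.rpow_nonneg hs (p x)]
    · linarith [Real.rpow_le_rpow_of_exponent_le h (by linarith : p x - 1 ≤ p x)]
  refine (hbd x _ _).trans (le_trans ?_ (le_abs_self _))
  exact mul_le_mul (hab x).2.2 h1 (Real.rpow_nonneg hs _) hb0

/-- Caccioppoli inequality for `𝒜`-harmonic functions, with an integrable majorant `h` of the
cutoff term. -/
lemma IsAHarmonic.caccioppoli {n : ℕ} {p : Euc n → ℝ} {pm pP : ℝ}
    (hp : IsVarExp p pm pP) {𝒜 : Euc n → ℝ → Euc n → Euc n} {am bP : ℝ}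
    (h𝒜 : IsNSGrowth p 𝒜 am bP) {u : Euc n → ℝ} (hu : IsAHarmonic p 𝒜 u)
    {m : ℕ} (hm : pP ≤ m + 1) {η : Euc n → ℝ} (hη : ContDiff ℝ 1 η) (hηc : HasCompactSupport η)
    (hη0 : ∀ x, 0 ≤ η x) (hη1 : ∀ x, η x ≤ 1) {h : Euc n → ℝ} (hh : Integrable h)
    (hle : ∀ᵐ x, (2 * bP * (m + 1) / am * |u x| * ‖fderiv ℝ η x‖) ^ p x ≤ h x) :
    Integrable (fun x ↦ η x ^ (m + 1) * ‖gradient u x‖ ^ p x) ∧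
      ∫ x, η x ^ (m + 1) * ‖gradient u x‖ ^ p x ≤ ∫ x, h x := by
  have hF := hu.locallyIntegrable_flux hp h𝒜
  obtain ⟨a, b, -, -, hab, hcoer, hbd⟩ := h𝒜.growth
  have ham := h𝒜.am_pos
  have hb0 : 0 ≤ bP := by
    have := hab 0
    linarith
  have hηm : HasCompactSupport (fun x ↦ η x ^ (m + 1)) :=
    hηc.comp_left (g := fun t : ℝ ↦ t ^ (m + 1)) (by simp)
  have hint : Integrable (fun x ↦ η x ^ (m + 1) * ‖gradient u x‖ ^ p x) :=
    hu.2.1.integrable_smul_left_of_hasCompactSupport (hη.continuous.pow _) hηm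
  refine ⟨hint, ?_⟩
  set g : Euc n → ℝ := fun x ↦ u x * η x ^ (m + 1)
  have hg : ContDiff ℝ 1 g := hu.1.mul (hη.pow _)
  have hgc : HasCompactSupport g := hηm.mul_left
  have hzero := integral_inner_gradient_eq_zero hF hu.2.2 hg hgc
  have hgi := integrable_inner_gradient hF hg hgc
  have hpt : ∀ᵐ x, am / 2 * (η x ^ (m + 1) * ‖gradient u x‖ ^ p x) ≤
      inner ℝ (𝒜 x (u x) (gradient u x)) (gradient g x) + am / 2 * h x := by
    filter_upwards [hp.ae_lb, hp.ae_ub, hle] with x hx1 hx2 hx3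
    set F := 𝒜 x (u x) (gradient u x)
    set s := ‖gradient u x‖
    set Y := 2 * bP * (m + 1) / am * |u x| * ‖fderiv ℝ η x‖ with hY
    have hs0 : 0 ≤ s := norm_nonneg _
    have hY0 : 0 ≤ Y := by positivity
    have hyoung := mul_rpow_sub_one_mul_pow_le hs0 (hη0 x) (hη1 x) hY0
      (hp.one_lt.trans_le hx1) (hx2.trans hm)
    have hdu : DifferentiableAt ℝ u x := hu.1.differentiable one_ne_zero x
    have hdη : DifferentiableAt ℝ η x := hη.differentiable one_ne_zero x
    have hdg : fderiv ℝ g x F = η x ^ (m + 1) * fderiv ℝ u x F +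
        (m + 1) * η x ^ m * u x * fderiv ℝ η x F := by
      have := (hdu.hasFDerivAt.mul (hdη.hasFDerivAt.pow (m + 1))).fderiv
      rw [show g = u * fun x ↦ η x ^ (m + 1) from rfl, this]
      simp
      ring
    have hin : inner ℝ F (gradient g x) = fderiv ℝ g x F := by
      rw [inner_gradient_right]; rfl
    have hiu : inner ℝ F (gradient u x) = fderiv ℝ u x F := by
      rw [inner_gradient_right]; rfl
    have hc : am * s ^ p x ≤ fderiv ℝ u x F := by
      rw [← hiu]
      exact (mul_le_mul_of_nonneg_right (hab x).1 (Real.rpow_nonneg hs0 _)).trans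
        (hcoer x (u x) (gradient u x))
    have hFb : ‖F‖ ≤ bP * s ^ (p x - 1) :=
      (hbd x (u x) (gradient u x)).trans
        (mul_le_mul_of_nonneg_right (hab x).2.2 (Real.rpow_nonneg hs0 _))
    have hηm0 : 0 ≤ η x ^ m := pow_nonneg (hη0 x) m
    have hcross : |(m + 1) * η x ^ m * u x * fderiv ℝ η x F| ≤
        am / 2 * (Y * s ^ (p x - 1) * η x ^ m) := by
      have e1 : |fderiv ℝ η x F| ≤ ‖fderiv ℝ η x‖ * (bP * s ^ (p x - 1)) :=
        ((fderiv ℝ η x).le_opNorm F).trans (by gcongr)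
      rw [abs_mul, abs_mul, abs_of_nonneg (by positivity : 0 ≤ ((m : ℝ) + 1) * η x ^ m)]
      calc (m + 1) * η x ^ m * |u x| * |fderiv ℝ η x F|
          ≤ (m + 1) * η x ^ m * |u x| * (‖fderiv ℝ η x‖ * (bP * s ^ (p x - 1))) := by gcongr
        _ = am / 2 * (Y * s ^ (p x - 1) * η x ^ m) := by
          rw [hY]; field_simp
    rw [hin, hdg]
    have h1 := neg_le_of_abs_le hcross
    have h2 := mul_le_mul_of_nonneg_left hc (pow_nonneg (hη0 x) (m + 1))
    have h3 := mul_le_mul_of_nonneg_left (hyoung.trans (by gcongr : _ ≤ s ^ p x * η x ^ (m + 1) +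
      h x)) (by positivity : 0 ≤ am / 2)
    linarith
  have hmono := integral_mono_ae (hint.const_mul (am / 2)) (hgi.add (hh.const_mul (am / 2))) hpt
  simp only [Pi.add_apply] at hmono
  rw [integral_add hgi (hh.const_mul _), hzero, integral_const_mul, integral_const_mul,
    zero_add] at hmono
  exact le_of_mul_le_mul_left hmono (by positivity)

/-- Rescaled smooth cutoffs: equal to one on the ball of radius `r`, supported well inside the ball
of radius `2r`, with gradient of size `L / r` carried by the annulus in between. -/
lemma exists_cutoff (n : ℕ) : ∃ L : ℝ, 0 ≤ L ∧ ∀ r : ℝ, 0 < r → ∃ η : Euc n → ℝ,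
    ContDiff ℝ 1 η ∧ HasCompactSupport η ∧ (∀ x, 0 ≤ η x) ∧ (∀ x, η x ≤ 1) ∧
    (∀ x ∈ ball (0 : Euc n) r, η x = 1) ∧ (∀ x, ‖fderiv ℝ η x‖ ≤ L / r) ∧
    ∀ x, fderiv ℝ η x ≠ 0 → x ∈ ball (0 : Euc n) (2 * r) \ ball 0 r := by
  let f : ContDiffBump (0 : Euc n) := ⟨1, 3 / 2, by norm_num, by norm_num⟩
  obtain ⟨L, hL⟩ := ((f.contDiff (n := 1)).continuous_fderiv
    one_ne_zero).bounded_above_of_compact_support (f.hasCompactSupport.fderiv (𝕜 := ℝ))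
  have hL0 : 0 ≤ L := (norm_nonneg _).trans (hL 0)
  refine ⟨L, hL0, fun r hr ↦ ?_⟩
  let η : Euc n → ℝ := fun x ↦ f (r⁻¹ • x)
  have hηd : ContDiff ℝ 1 η := f.contDiff.comp (contDiff_const_smul _)
  have hone : ∀ x ∈ ball (0 : Euc n) r, η x = 1 := by
    intro x hx
    apply f.one_of_mem_closedBall
    rw [mem_ball_zero_iff] at hx
    rw [mem_closedBall_zero_iff, norm_smul, norm_inv, Real.norm_of_nonneg hr.le]
    rw [inv_mul_le_iff₀ hr]
    change ‖x‖ ≤ r * 1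
    linarith
  have hzero : ∀ x ∉ closedBall (0 : Euc n) (3 / 2 * r), η x = 0 := by
    intro x hx
    apply f.zero_of_le_dist
    rw [mem_closedBall_zero_iff, not_le] at hx
    rw [dist_zero_right, norm_smul, norm_inv, Real.norm_of_nonneg hr.le, le_inv_mul_iff₀ hr]
    change r * (3 / 2) ≤ ‖x‖
    linarith
  have hsupp : tsupport η ⊆ closedBall 0 (3 / 2 * r) :=
    closure_minimal (fun x hx ↦ by_contra fun h ↦ hx (hzero x h)) isClosed_closedBall
  refine ⟨η, hηd, HasCompactSupport.intro (isCompact_closedBall 0 (3 / 2 * r)) hzero,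
    fun x ↦ f.nonneg, fun x ↦ f.le_one, hone, fun x ↦ ?_, fun x hx ↦ ⟨?_, fun hxr ↦ hx ?_⟩⟩
  · have : fderiv ℝ η x = r⁻¹ • fderiv ℝ f (r⁻¹ • x) := fderiv_comp_smul r⁻¹
    rw [this, norm_smul, norm_inv, Real.norm_of_nonneg hr.le, div_eq_inv_mul]
    exact mul_le_mul_of_nonneg_left (hL _) (by positivity)
  · refine closedBall_subset_ball (by linarith) (hsupp (support_fderiv_subset ℝ hx))
  · have : η =ᶠ[nhds x] fun _ ↦ (1 : ℝ) :=
      Filter.eventually_of_mem (isOpen_ball.mem_nhds hxr) hone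
    rw [this.fderiv_eq]
    simp

/-- The energy in `B_r` is controlled by the size of `u` on the annulus `B_{2r} \ B_r`. -/
lemma IsAHarmonic.setIntegral_ball_le {n : ℕ} {p : Euc n → ℝ} {pm pP : ℝ}
    (hp : IsVarExp p pm pP) {𝒜 : Euc n → ℝ → Euc n → Euc n} {am bP : ℝ}
    (h𝒜 : IsNSGrowth p 𝒜 am bP) {u : Euc n → ℝ} (hu : IsAHarmonic p 𝒜 u) {c : ℝ} (hc : 0 ≤ c) :
    ∃ D : ℝ, 0 ≤ D ∧ ∀ (α r : ℝ), 0 < r → D * r ^ (-(α + 1)) ≤ 1 →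
      (∀ x ∈ ball (0 : Euc n) (2 * r) \ ball 0 r, |u x| ≤ c * r ^ (-α)) →
      ∫ x in ball (0 : Euc n) r, ‖gradient u x‖ ^ p x ≤
        (D * r ^ (-(α + 1))) ^ pm * volume.real (ball (0 : Euc n) (2 * r)) := by
  obtain ⟨L, hL0, hL⟩ := exists_cutoff n
  obtain ⟨m, hm⟩ := exists_nat_ge pP
  have ham := h𝒜.am_pos
  have hb0 : 0 ≤ bP := by
    obtain ⟨a, b, -, -, hab, -⟩ := h𝒜.growth
    have := hab 0
    linarith
  refine ⟨2 * bP * (m + 1) / am * c * L, by positivity, fun α r hr hD hdec ↦ ?_⟩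
  obtain ⟨η, hη, hηc, hη0, hη1, hone, hder, hann⟩ := hL r hr
  set y := 2 * bP * (m + 1) / am * c * L * r ^ (-(α + 1)) with hy
  have hy0 : 0 ≤ y := by positivity
  have hyeq : y = 2 * bP * (m + 1) / am * (c * r ^ (-α)) * (L / r) := by
    rw [hy, neg_add, ← sub_eq_add_neg, Real.rpow_sub_one hr.ne']
    ring
  have hfin : volume (ball (0 : Euc n) (2 * r)) ≠ ⊤ := measure_ball_lt_top.ne
  have hh : Integrable ((ball (0 : Euc n) (2 * r)).indicator fun _ ↦ y ^ pm) :=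
    (integrable_indicator_iff measurableSet_ball).2 (integrableOn_const hfin)
  have hpm : 1 < pm := hp.one_lt
  have hle : ∀ᵐ x, (2 * bP * (m + 1) / am * |u x| * ‖fderiv ℝ η x‖) ^ p x ≤
      (ball (0 : Euc n) (2 * r)).indicator (fun _ ↦ y ^ pm) x := by
    filter_upwards [hp.ae_lb] with x hx
    by_cases hd : fderiv ℝ η x = 0
    · rw [hd, norm_zero, mul_zero, Real.zero_rpow (by linarith)]
      exact Set.indicator_nonneg (fun _ _ ↦ Real.rpow_nonneg hy0 _) x
    · have hxa := hann x hd
      rw [Set.indicator_of_mem hxa.1]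
      have h1 : 2 * bP * (m + 1) / am * |u x| * ‖fderiv ℝ η x‖ ≤ y := by
        rw [hyeq]
        have := hdec x hxa
        have := hder x
        gcongr
      calc _ ≤ y ^ p x := Real.rpow_le_rpow (by positivity) h1 (by linarith)
        _ ≤ y ^ pm := Real.rpow_le_rpow_of_exponent_ge_of_imp hy0 hD hx (by intros; linarith)
  obtain ⟨hi, hC⟩ := hu.caccioppoli hp h𝒜 (hm.trans (by linarith)) hη hηc hη0 hη1 hh hle
  have hnn : ∀ x, 0 ≤ η x ^ (m + 1) * ‖gradient u x‖ ^ p x := fun x ↦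
    mul_nonneg (pow_nonneg (hη0 x) _) (Real.rpow_nonneg (norm_nonneg _) _)
  calc ∫ x in ball (0 : Euc n) r, ‖gradient u x‖ ^ p x
      = ∫ x in ball (0 : Euc n) r, η x ^ (m + 1) * ‖gradient u x‖ ^ p x :=
        setIntegral_congr_fun measurableSet_ball fun x hx ↦ by simp [hone x hx]
    _ ≤ ∫ x, η x ^ (m + 1) * ‖gradient u x‖ ^ p x :=
        setIntegral_le_integral hi (.of_forall hnn)
    _ ≤ _ := hC
    _ = y ^ pm * volume.real (ball (0 : Euc n) (2 * r)) := by
        rw [integral_indicator measurableSet_ball, setIntegral_const, smul_eq_mul, mul_comm]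

/-- An `𝒜`-harmonic function with vanishing energy on balls has zero derivative. -/
lemma IsAHarmonic.fderiv_eq_zero {n : ℕ} {p : Euc n → ℝ} {pm pP : ℝ}
    (hp : IsVarExp p pm pP) {𝒜 : Euc n → ℝ → Euc n → Euc n} {u : Euc n → ℝ}
    (hu : IsAHarmonic p 𝒜 u)
    (h : ∀ r : ℕ, ∫ x in ball (0 : Euc n) r, ‖gradient u x‖ ^ p x = 0) (x : Euc n) :
    fderiv ℝ u x = 0 := by
  have hnn : ∀ x, 0 ≤ ‖gradient u x‖ ^ p x := fun x ↦ Real.rpow_nonneg (norm_nonneg _) _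
  have hball : ∀ r : ℕ, ∀ᵐ x, x ∈ ball (0 : Euc n) r → ‖gradient u x‖ ^ p x = 0 := by
    intro r
    have hi : IntegrableOn (fun x ↦ ‖gradient u x‖ ^ p x) (ball (0 : Euc n) r) :=
      (hu.2.1.integrableOn_isCompact (isCompact_closedBall 0 (r : ℝ))).mono_set
        ball_subset_closedBall
    have := (setIntegral_eq_zero_iff_of_nonneg_ae (.of_forall hnn) hi).1 (h r)
    exact (ae_restrict_iff' measurableSet_ball).1 this
  have hae : fderiv ℝ u =ᵐ[volume] fun _ ↦ 0 := by
    filter_upwards [ae_all_iff.2 hball, hp.ae_lb] with x hx hpx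
    obtain ⟨r, hr⟩ := exists_nat_gt ‖x‖
    have h0 := hx r (by simpa using hr)
    rw [Real.rpow_eq_zero (norm_nonneg _) (by linarith [hp.one_lt]), norm_eq_zero] at h0
    rw [← toDual_gradient, h0, map_zero]
  exact congrFun (((hu.1.continuous_fderiv one_ne_zero).ae_eq_iff_eq volume
    continuous_const).1 hae) x

/-- Theorem 3.7: let `n ≥ 2`, `p⁻ < n` and `α > n/p⁻ − 1`. If a bounded `𝒜`-harmonic
function `u` satisfies `|u| ≤ c R_k^{−α}` on annuli `B_{2R_k}∖B_{R_k}` for some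
sequence `R_k → ∞`, then `u` is constant. -/
theorem liouville_decay {n : ℕ} (hn : 2 ≤ n) (p : Euc n → ℝ) (pm pP : ℝ)
    (hp : IsVarExp p pm pP) (hpmn : pm < (n : ℝ))
    (𝒜 : Euc n → ℝ → Euc n → Euc n) (am bP : ℝ)
    (h𝒜 : IsNSGrowth p 𝒜 am bP)
    (α : ℝ) (hα : (n : ℝ) / pm - 1 < α)
    (c : ℝ) (hc : 0 < c)
    (R : ℕ → ℝ) (hRpos : ∀ k, 0 < R k) (hRmono : StrictMono R)
    (hRtop : Filter.Tendsto R Filter.atTop Filter.atTop)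
    (u : Euc n → ℝ) (hu : IsAHarmonic p 𝒜 u)
    (hdecay : ∀ k, ∀ x ∈ Metric.ball (0 : Euc n) (2 * R k) \ Metric.ball 0 (R k),
      |u x| ≤ c * (R k) ^ (-α))
    (M : ℝ) (hbdd : ∀ x, |u x| ≤ M) :
    ∃ C : ℝ, ∀ x, u x = C := by
  obtain ⟨D, hD0, hD⟩ := hu.setIntegral_ball_le hp h𝒜 hc.le
  have hpm : 0 < pm := by linarith [hp.one_lt]
  have hα' : (n : ℝ) < (α + 1) * pm := by
    rw [← div_lt_iff₀ hpm]
    linarith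
  have hα1 : 0 < α + 1 := by
    by_contra hneg
    nlinarith [Nat.cast_nonneg (α := ℝ) n]
  set V := volume.real (ball (0 : Euc n) 1)
  have hvol : ∀ r : ℝ, 0 < r → (D * r ^ (-(α + 1))) ^ pm * volume.real (ball (0 : Euc n) (2 * r)) =
      D ^ pm * 2 ^ n * V * r ^ (-((α + 1) * pm - n)) := by
    intro r hr
    have h1 : volume.real (ball (0 : Euc n) (2 * r)) = (2 * r) ^ n * V := by
      rw [measureReal_def, Measure.addHaar_ball_of_pos volume 0 (by positivity : 0 < 2 * r),
        ENNReal.toReal_mul, ENNReal.toReal_ofReal (by positivity), finrank_euclideanSpace,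
        Fintype.card_fin]
      rfl
    rw [h1, Real.mul_rpow hD0 (by positivity), ← Real.rpow_mul hr.le, mul_pow,
      show -((α + 1) * pm - n) = -(α + 1) * pm + (n : ℝ) by ring, Real.rpow_add hr,
      Real.rpow_natCast]
    ring
  have hlim : Filter.Tendsto (fun k ↦ D ^ pm * 2 ^ n * V * (R k) ^ (-((α + 1) * pm - n)))
      Filter.atTop (nhds 0) := by
    simpa using ((tendsto_rpow_neg_atTop (sub_pos.2 hα')).comp hRtop).const_mul
      (D ^ pm * 2 ^ n * V)
  have hsmall : ∀ᶠ k in Filter.atTop, D * (R k) ^ (-(α + 1)) ≤ 1 := by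
    have : Filter.Tendsto (fun k ↦ D * (R k) ^ (-(α + 1))) Filter.atTop (nhds 0) := by
      simpa using ((tendsto_rpow_neg_atTop hα1).comp hRtop).const_mul D
    exact this.eventually_le_const one_pos
  have hnn : ∀ x, 0 ≤ ‖gradient u x‖ ^ p x := fun x ↦ Real.rpow_nonneg (norm_nonneg _) _
  refine ⟨u 0, fun x ↦ is_const_of_fderiv_eq_zero (𝕜 := ℝ) (hu.1.differentiable one_ne_zero)
    (hu.fderiv_eq_zero hp fun r ↦ le_antisymm ?_ (integral_nonneg hnn)) x 0⟩
  refine ge_of_tendsto hlim ?_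
  filter_upwards [hsmall, hRtop.eventually_ge_atTop (r : ℝ)] with k hk hkr
  rw [← hvol _ (hRpos k)]
  refine le_trans (setIntegral_mono_set ?_ (.of_forall hnn)
    (ball_subset_ball hkr).eventuallyLE) (hD α (R k) (hRpos k) hk (hdecay k))
  exact (hu.2.1.integrableOn_isCompact (isCompact_closedBall 0 (R k))).mono_set
    ball_subset_closedBall

end
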